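/- SRT are closed under intersection: for all SRT T₁ and T₂ over U there exists an SRT T over U such that Match(T,S) = Match(T₁,S) ∩ Match(T₂,S) for every string S over U. -/

import Mathlib

open scoped Classical

/-- A valuation over registers `R` with data elements from `U`:
a partial function from registers to data elements. -/
abbrev Val (U R : Type*) := R → Option U

/-- The everywhere-undefined valuation `♯`. -/
def Val.sharp {U R : Type*} : Val U R := fun _ => none

/-- `v.updateW W u` updates every register in `W` to hold `u`. -/
noncomputable def Val.updateW {U R : Type*} (v : Val U R) (W : Set R) (u : U) :
    Val U R := fun r => if r ∈ W then some u else v r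

/-- A condition over `(U, R)`: an arbitrary predicate on pairs of a data
element and a valuation. -/
abbrev Cond (U R : Type*) := U → Val U R → Prop

/-- `MatchCat M₁ M₂ M` states that `M = M₁ · M₂`: `M₁` and `M₂` are disjoint,
`M` is their union, and every position of `M₁` is smaller than every position
of `M₂`. -/
def MatchCat (M₁ M₂ M : Finset ℕ) : Prop :=
  Disjoint M₁ M₂ ∧ M = M₁ ∪ M₂ ∧ ∀ i ∈ M₁, ∀ j ∈ M₂, i < j

/-- Symbolic regular expressions with memory and output over `(U, R)`.
The output `true` stands for `•` and `false` for `⊗`. -/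
inductive SREMO (U R : Type*) where
  | empty : SREMO U R
  | eps : SREMO U R
  | cond (φ : Cond U R) (o : Bool) : SREMO U R
  | condW (φ : Cond U R) (o : Bool) (r : R) : SREMO U R
  | plus (e₁ e₂ : SREMO U R) : SREMO U R
  | cat (e₁ e₂ : SREMO U R) : SREMO U R
  | star (e : SREMO U R) : SREMO U R

/-- The relation `(e, S, M, v) ⊢ v'`, where the `ℕ` argument is the absolute
position (1-based) in the ambient string of the first element of the slice `S`;
positions recorded in `M` are absolute positions. -/
inductive SREMO.Derives {U R : Type*} :
    SREMO U R → ℕ → List U → Finset ℕ → Val U R → Val U R → Prop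
  | eps (off : ℕ) (v : Val U R) : Derives .eps off [] ∅ v v
  | cond {φ : Cond U R} {o : Bool} (off : ℕ) {u : U} {v : Val U R} :
      φ u v → Derives (.cond φ o) off [u] (if o then {off} else ∅) v v
  | condW {φ : Cond U R} {o : Bool} {r : R} (off : ℕ) {u : U} {v : Val U R} :
      φ u v →
      Derives (.condW φ o r) off [u] (if o then {off} else ∅) v (v.updateW {r} u)
  | plusL {e₁ e₂ : SREMO U R} {off : ℕ} {S : List U} {M : Finset ℕ}
      {v v' : Val U R} :
      Derives e₁ off S M v v' → Derives (.plus e₁ e₂) off S M v v'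
  | plusR {e₁ e₂ : SREMO U R} {off : ℕ} {S : List U} {M : Finset ℕ}
      {v v' : Val U R} :
      Derives e₂ off S M v v' → Derives (.plus e₁ e₂) off S M v v'
  | cat {e₁ e₂ : SREMO U R} {off : ℕ} {S₁ S₂ : List U} {M₁ M₂ M : Finset ℕ}
      {v v'' v' : Val U R} :
      MatchCat M₁ M₂ M → Derives e₁ off S₁ M₁ v v'' →
      Derives e₂ (off + S₁.length) S₂ M₂ v'' v' →
      Derives (.cat e₁ e₂) off (S₁ ++ S₂) M v v'
  | starNil {e : SREMO U R} (off : ℕ) (v : Val U R) :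
      Derives (.star e) off [] ∅ v v
  | starCons {e : SREMO U R} {off : ℕ} {S₁ S₂ : List U} {M₁ M₂ M : Finset ℕ}
      {v v'' v' : Val U R} :
      S₁ ≠ [] → MatchCat M₁ M₂ M → Derives e off S₁ M₁ v v'' →
      Derives (.star e) (off + S₁.length) S₂ M₂ v'' v' →
      Derives (.star e) off (S₁ ++ S₂) M v v'

/-- `Lang(e)`: the strings derivable from `e` starting with all registers empty. -/
def SREMO.Lang {U R : Type*} (e : SREMO U R) : Set (List U) :=
  {S | ∃ (M : Finset ℕ) (v' : Val U R), e.Derives 1 S M Val.sharp v'}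

/-- `Match(e, S)`: the matches of `e` on the string `S`. -/
def SREMO.Matches {U R : Type*} (e : SREMO U R) (S : List U) : Set (Finset ℕ) :=
  {M | ∃ v' : Val U R, e.Derives 1 S M Val.sharp v'}

/-- The window constraint: whenever `M ≠ ∅`, `max M - min M + 1 ≤ w`. -/
def WindowOK (M : Finset ℕ) (w : ℕ) : Prop :=
  ∀ h : M.Nonempty, M.max' h - M.min' h + 1 ≤ w

/-- `Lang(e^[1..w])`: the language of the windowed SREMO `e^[1..w]`. -/
def SREMO.WLang {U R : Type*} (e : SREMO U R) (w : ℕ) : Set (List U) :=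
  {S | ∃ (M : Finset ℕ) (v' : Val U R),
    e.Derives 1 S M Val.sharp v' ∧ WindowOK M w}

/-- A transition of a symbolic register transducer: source, condition
(`none` denotes `ε`), write registers, target, output (`true` is `•`). -/
structure SRTTransition (U State Reg : Type*) where
  src : State
  cond : Option (Cond U Reg)
  wr : Set Reg
  tgt : State
  out : Bool

/-- A symbolic register transducer over `U`. -/
structure SRT (U : Type*) where
  State : Type
  Reg : Type
  stateFinite : Finite State
  regFinite : Finite Reg
  start : State
  final : Set State
  trans : Set (SRTTransition U State Reg)
  transFinite : trans.Finite

/-- A configuration: position, current state, current valuation. -/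
structure SRTConfig (U State Reg : Type*) where
  pos : ℕ
  state : State
  val : Val U Reg

/-- `c'` is a successor of `c` via the transition `δ`, while reading `S`. -/
def SRT.Step {U : Type*} (T : SRT U) (S : List U)
    (δ : SRTTransition U T.State T.Reg)
    (c c' : SRTConfig U T.State T.Reg) : Prop :=
  δ ∈ T.trans ∧ δ.src = c.state ∧ δ.tgt = c'.state ∧
    ((δ.cond = none ∧ c'.pos = c.pos ∧ c'.val = c.val) ∨
      (∃ (φ : Cond U T.Reg) (u : U), δ.cond = some φ ∧
        S[c.pos - 1]? = some u ∧ φ u c.val ∧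
        c'.pos = c.pos + 1 ∧ c'.val = c.val.updateW δ.wr u))

/-- The positions marked when a transition `δ` is taken at position `j`:
`{j}` if `δ` is a non-ε transition with output `•`, and `∅` otherwise. -/
def SRTTransition.mark {U State Reg : Type*} (δ : SRTTransition U State Reg)
    (j : ℕ) : Finset ℕ :=
  match δ.cond, δ.out with
  | some _, true => {j}
  | _, _ => ∅

/-- A run of `T` over `S` from configuration `c` to configuration `c'`,
via the list of transitions `δs`, producing the match `M`. -/
inductive SRT.Run {U : Type*} (T : SRT U) (S : List U) :
    SRTConfig U T.State T.Reg → List (SRTTransition U T.State T.Reg) →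
      Finset ℕ → SRTConfig U T.State T.Reg → Prop
  | nil (c : SRTConfig U T.State T.Reg) : Run T S c [] ∅ c
  | cons {c c' c'' : SRTConfig U T.State T.Reg}
      {δ : SRTTransition U T.State T.Reg}
      {δs : List (SRTTransition U T.State T.Reg)} {M : Finset ℕ} :
      T.Step S δ c c' → Run T S c' δs M c'' →
      Run T S c (δ :: δs) (δ.mark c.pos ∪ M) c''

/-- The initial configuration `[1, q_s, ♯]`. -/
def SRT.init {U : Type*} (T : SRT U) : SRTConfig U T.State T.Reg :=
  ⟨1, T.start, Val.sharp⟩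

/-- `T` has an accepting run over `S` with match `M`: a run starting at
`[1, q_s, ♯]`, ending at position `|S| + 1` in a final state, whose last
transition has output `•`. -/
def SRT.AccMatch {U : Type*} (T : SRT U) (S : List U) (M : Finset ℕ) : Prop :=
  ∃ (δs : List (SRTTransition U T.State T.Reg)) (q : T.State)
    (v : Val U T.Reg) (δlast : SRTTransition U T.State T.Reg),
    T.Run S T.init δs M ⟨S.length + 1, q, v⟩ ∧ q ∈ T.final ∧
      δs.getLast? = some δlast ∧ δlast.out = true

/-- `Match(T, S)`: the matches of the accepting runs of `T` over `S`. -/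
def SRT.MatchSet {U : Type*} (T : SRT U) (S : List U) : Set (Finset ℕ) :=
  {M | T.AccMatch S M}

/-- `Lang(T)`: the strings over which `T` has an accepting run. -/
def SRT.Lang {U : Type*} (T : SRT U) : Set (List U) :=
  {S | ∃ M : Finset ℕ, T.AccMatch S M}

/-- `Lang_oa(T)`: the output-agnostic language of `T` (outputs ignored). -/
def SRT.LangOA {U : Type*} (T : SRT U) : Set (List U) :=
  {S | ∃ (δs : List (SRTTransition U T.State T.Reg)) (M : Finset ℕ)
      (q : T.State) (v : Val U T.Reg),
      T.Run S T.init δs M ⟨S.length + 1, q, v⟩ ∧ q ∈ T.final}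

/-- `T` has no ε-transitions. -/
def SRT.NoEps {U : Type*} (T : SRT U) : Prop :=
  ∀ δ ∈ T.trans, δ.cond ≠ none

/-- `T` is deterministic: it has no ε-transitions and, for every state, every
element and every valuation, at most one transition from that state has a
condition satisfied by them. -/
def SRT.Deterministic {U : Type*} (T : SRT U) : Prop :=
  T.NoEps ∧
    ∀ δ₁ ∈ T.trans, ∀ δ₂ ∈ T.trans,
      ∀ (φ₁ φ₂ : Cond U T.Reg) (u : U) (v : Val U T.Reg),
        δ₁.src = δ₂.src → δ₁.cond = some φ₁ → δ₂.cond = some φ₂ →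
          φ₁ u v → φ₂ u v → δ₁ = δ₂

/-- `T` is complete: for every state, element and valuation, at least one
transition from that state has a condition satisfied by them (together with
determinism this gives exactly one). -/
def SRT.Complete {U : Type*} (T : SRT U) : Prop :=
  ∀ (q : T.State) (u : U) (v : Val U T.Reg),
    ∃ δ ∈ T.trans, δ.src = q ∧ ∃ φ : Cond U T.Reg, δ.cond = some φ ∧ φ u v

/-- Iterated match concatenation: `MatchCatList [M₁, …, Mₙ] M` states that
`M = M₁ · M₂ ⋯ Mₙ`. -/
inductive MatchCatList : List (Finset ℕ) → Finset ℕ → Prop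
  | nil : MatchCatList [] ∅
  | cons {M₁ : Finset ℕ} {Ms : List (Finset ℕ)} {M' M : Finset ℕ} :
      MatchCatList Ms M' → MatchCat M₁ M' M → MatchCatList (M₁ :: Ms) M

/-- The output of the last transition of a run, or `b` for the empty run. -/
def lastOut {U State Reg : Type*} (b : Bool) (δs : List (SRTTransition U State Reg)) : Bool :=
  (δs.getLast?.map SRTTransition.out).getD b

theorem lastOut_cons {U State Reg : Type*} (b : Bool) (δ : SRTTransition U State Reg)
    (δs : List (SRTTransition U State Reg)) : lastOut b (δ :: δs) = lastOut δ.out δs := by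
  unfold lastOut
  rw [List.getLast?_cons]
  cases δs.getLast? <;> rfl

theorem mem_mark {U State Reg : Type*} (δ : SRTTransition U State Reg) (i j : ℕ) :
    i ∈ δ.mark j ↔ i = j ∧ δ.cond ≠ none ∧ δ.out = true := by
  unfold SRTTransition.mark
  rcases δ with ⟨_, _ | _, _, _, _ | _⟩ <;> simp

namespace SRT

variable {U : Type*}

/-- A configuration together with the output of the transition leading to it. -/
abbrev FlagConfig (T : SRT U) := SRTConfig U T.State T.Reg × Bool

/-- A step whose output agrees with membership of the current position in `M`. -/
inductive MStep (T : SRT U) (S : List U) (M : Finset ℕ) : T.FlagConfig → T.FlagConfig → Prop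
  | eps {δ : SRTTransition U T.State T.Reg} (j : ℕ) (v : Val U T.Reg) (b : Bool) :
      δ ∈ T.trans → δ.cond = none →
      MStep T S M (⟨j, δ.src, v⟩, b) (⟨j, δ.tgt, v⟩, δ.out)
  | read {δ : SRTTransition U T.State T.Reg} {φ : Cond U T.Reg} {u : U}
      (j : ℕ) (v : Val U T.Reg) (b : Bool) :
      δ ∈ T.trans → δ.cond = some φ → S[j - 1]? = some u → φ u v → (δ.out = true ↔ j ∈ M) →
      MStep T S M (⟨j, δ.src, v⟩, b) (⟨j + 1, δ.tgt, v.updateW δ.wr u⟩, δ.out)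

/-- Reachability by steps whose outputs agree with `M`. -/
abbrev MReach (T : SRT U) (S : List U) (M : Finset ℕ) : T.FlagConfig → T.FlagConfig → Prop :=
  Relation.ReflTransGen (T.MStep S M)

variable {T : SRT U} {S : List U} {M : Finset ℕ}

theorem Step.mStep {δ : SRTTransition U T.State T.Reg} {c c' : SRTConfig U T.State T.Reg}
    (h : T.Step S δ c c') (hM : δ.cond ≠ none → (δ.out = true ↔ c.pos ∈ M)) (b : Bool) :
    T.MStep S M (c, b) (c', δ.out) := by
  obtain ⟨j, q, v⟩ := c
  obtain ⟨j', q', v'⟩ := c'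
  obtain ⟨hδ, rfl, rfl, ⟨hc, hj, hv⟩ | ⟨φ, u, hc, hu, hφ, hj, hv⟩⟩ := h
  · obtain rfl : j' = j := hj
    obtain rfl : v' = v := hv
    exact .eps _ _ _ hδ hc
  · obtain rfl : j' = j + 1 := hj
    obtain rfl : v' = v.updateW δ.wr u := hv
    exact .read _ _ _ hδ hc hu hφ (hM (by simp [hc]))

theorem MStep.exists_step {x y : T.FlagConfig} (h : T.MStep S M x y) :
    ∃ δ, T.Step S δ x.1 y.1 ∧ δ.out = y.2 ∧
      (δ.cond ≠ none → (δ.out = true ↔ x.1.pos ∈ M)) := by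
  cases h with
  | eps j v b hδ hc => exact ⟨_, ⟨hδ, rfl, rfl, .inl ⟨hc, rfl, rfl⟩⟩, rfl, fun h => absurd hc h⟩
  | read j v b hδ hc hu hφ hM =>
    exact ⟨_, ⟨hδ, rfl, rfl, .inr ⟨_, _, hc, hu, hφ, rfl, rfl⟩⟩, rfl, fun _ => hM⟩

theorem Step.pos_eq {δ : SRTTransition U T.State T.Reg} {c c' : SRTConfig U T.State T.Reg}
    (h : T.Step S δ c c') :
    (δ.cond = none ∧ c'.pos = c.pos) ∨ (δ.cond ≠ none ∧ c'.pos = c.pos + 1) := by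
  obtain ⟨-, -, -, ⟨hc, hj, -⟩ | ⟨φ, u, hc, -, -, hj, -⟩⟩ := h
  · exact .inl ⟨hc, hj⟩
  · exact .inr ⟨by simp [hc], hj⟩

theorem Run.pos_le {c c' : SRTConfig U T.State T.Reg} {δs : List _}
    (h : T.Run S c δs M c') : c.pos ≤ c'.pos := by
  induction h with
  | nil => exact le_rfl
  | cons hs _ ih => rcases hs.pos_eq with h | h <;> omega

theorem Run.mem_bounds {c c' : SRTConfig U T.State T.Reg} {δs : List _}
    (h : T.Run S c δs M c') : ∀ j ∈ M, c.pos ≤ j ∧ j < c'.pos := by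
  induction h with
  | nil => simp
  | cons hs hr ih =>
    intro j hj
    have hle := hr.pos_le
    rcases Finset.mem_union.1 hj with hj | hj
    · obtain ⟨rfl, hc, -⟩ := (mem_mark _ _ _).1 hj
      rcases hs.pos_eq with h | h
      · exact absurd h.1 hc
      · omega
    · have := ih j hj
      rcases hs.pos_eq with h | h <;> omega

theorem Run.mReach {c c' : SRTConfig U T.State T.Reg} {δs : List _} {N : Finset ℕ}
    (h : T.Run S c δs N c') (hM : ∀ j, c.pos ≤ j → (j ∈ M ↔ j ∈ N)) (b : Bool) :
    T.MReach S M (c, b) (c', lastOut b δs) := by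
  induction h generalizing b with
  | nil => exact .refl
  | @cons c c' c'' δ δs N hs hr ih =>
    rw [lastOut_cons]
    have hpos := hs.pos_eq
    refine .head (hs.mStep (fun hc => ?_) b) (ih (fun j hj => ?_) _)
    · rw [hM _ le_rfl, Finset.mem_union, mem_mark]
      have : c.pos ∉ N := fun h => by
        have := hr.mem_bounds _ h
        have := hpos.resolve_left (fun h => hc h.1)
        omega
      simp [hc, this]
    · rw [hM j (by omega), Finset.mem_union, mem_mark]
      refine or_iff_right ?_
      rintro ⟨rfl, hc, -⟩
      have := hpos.resolve_left (fun h => hc h.1)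
      omega

theorem MReach.exists_run {x y : T.FlagConfig} (h : T.MReach S M x y) :
    ∃ δs, T.Run S x.1 δs {j ∈ M | x.1.pos ≤ j ∧ j < y.1.pos} y.1 ∧ lastOut x.2 δs = y.2 := by
  induction h using Relation.ReflTransGen.head_induction_on with
  | refl =>
    refine ⟨[], ?_, rfl⟩
    rw [Finset.filter_false_of_mem (fun j _ => by omega)]
    exact .nil _
  | @head x z hs _ ih =>
    obtain ⟨δs, hr, hl⟩ := ih
    obtain ⟨δ, hδ, ho, hM⟩ := hs.exists_step
    refine ⟨δ :: δs, ?_, by rw [lastOut_cons, ho, hl]⟩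
    convert Run.cons hδ hr using 1
    have hle := hr.pos_le
    ext j
    simp only [Finset.mem_filter, Finset.mem_union, mem_mark]
    rcases hδ.pos_eq with ⟨hc, hp⟩ | ⟨hc, hp⟩
    · simp [hc, hp]
    · have := hM hc
      rw [hp]
      by_cases hj : j = x.1.pos
      · subst hj
        simp [hc, this]
        omega
      · simp only [hj, false_and, false_or]
        refine and_congr_right fun _ => ?_
        omega

theorem accMatch_iff :
    T.AccMatch S M ↔ (∀ j ∈ M, 1 ≤ j ∧ j < S.length + 1) ∧
      ∃ q ∈ T.final, ∃ v, T.MReach S M (T.init, false) (⟨S.length + 1, q, v⟩, true) := by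
  constructor
  · rintro ⟨δs, q, v, δ, hr, hq, hl, ho⟩
    refine ⟨hr.mem_bounds, q, hq, v, ?_⟩
    have := hr.mReach (M := M) (fun _ _ => Iff.rfl) false
    rwa [lastOut, hl, Option.map_some, Option.getD_some, ho] at this
  · rintro ⟨hM, q, hq, v, h⟩
    obtain ⟨δs, hr, hl⟩ := MReach.exists_run h
    replace hr : T.Run S T.init δs {j ∈ M | 1 ≤ j ∧ j < S.length + 1} ⟨S.length + 1, q, v⟩ := hr
    rw [Finset.filter_true_of_mem hM] at hr
    cases hδ : δs.getLast? with
    | none => simp [lastOut, hδ] at hl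
    | some δ => exact ⟨δs, q, v, δ, hr, hq, hδ, by simpa [lastOut, hδ] using hl⟩

theorem MReach.one_le_pos {x : T.FlagConfig} (h : T.MReach S M (T.init, false) x) :
    1 ≤ x.1.pos := by
  induction h with
  | refl => exact le_rfl
  | tail _ hs ih => cases hs <;> simp_all

section Inter

/-- States of the product: the component states with the outputs last produced by the two
components, and an additional accepting state `none`. -/
abbrev InterState (T₁ T₂ : SRT U) := Option (T₁.State × T₂.State × Bool × Bool)

abbrev InterTransition (T₁ T₂ : SRT U) :=
  SRTTransition U (InterState T₁ T₂) (T₁.Reg ⊕ T₂.Reg)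

variable (T₁ T₂ : SRT U)

/-- Both components read the same element. -/
def interRead (p : (SRTTransition U T₁.State T₁.Reg × SRTTransition U T₂.State T₂.Reg) ×
    Bool × Bool) : InterTransition T₁ T₂ where
  src := some (p.1.1.src, p.1.2.src, p.2)
  cond := p.1.1.cond.bind fun φ₁ => p.1.2.cond.map fun φ₂ u v =>
    φ₁ u (v ∘ Sum.inl) ∧ φ₂ u (v ∘ Sum.inr)
  wr := Sum.inl '' p.1.1.wr ∪ Sum.inr '' p.1.2.wr
  tgt := some (p.1.1.tgt, p.1.2.tgt, p.1.1.out, p.1.2.out)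
  out := p.1.1.out

theorem interRead_cond {T₁ T₂ : SRT U} {δ₁ : SRTTransition U T₁.State T₁.Reg}
    {δ₂ : SRTTransition U T₂.State T₂.Reg} {φ₁ : Cond U T₁.Reg} {φ₂ : Cond U T₂.Reg}
    (h₁ : δ₁.cond = some φ₁) (h₂ : δ₂.cond = some φ₂) (b : Bool × Bool) :
    (interRead T₁ T₂ ((δ₁, δ₂), b)).cond =
      some fun u v => φ₁ u (v ∘ Sum.inl) ∧ φ₂ u (v ∘ Sum.inr) := by
  simp only [interRead, h₁, h₂, Option.bind_some, Option.map_some]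

/-- The first component takes an ε-transition. -/
def interEpsLeft (p : SRTTransition U T₁.State T₁.Reg × T₂.State × Bool × Bool) :
    InterTransition T₁ T₂ where
  src := some (p.1.src, p.2)
  cond := none
  wr := ∅
  tgt := some (p.1.tgt, p.2.1, p.1.out, p.2.2.2)
  out := false

/-- The second component takes an ε-transition. -/
def interEpsRight (p : SRTTransition U T₂.State T₂.Reg × T₁.State × Bool × Bool) :
    InterTransition T₁ T₂ where
  src := some (p.2.1, p.1.src, p.2.2)
  cond := none
  wr := ∅
  tgt := some (p.2.1, p.1.tgt, p.2.2.1, p.1.out)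
  out := false

/-- Both components accept. -/
def interAccept (p : T₁.State × T₂.State) : InterTransition T₁ T₂ where
  src := some (p.1, p.2, true, true)
  cond := none
  wr := ∅
  tgt := none
  out := true

/-- The product transducer. -/
def inter : SRT U where
  State := InterState T₁ T₂
  Reg := T₁.Reg ⊕ T₂.Reg
  stateFinite := by
    have := T₁.stateFinite
    have := T₂.stateFinite
    infer_instance
  regFinite := by
    have := T₁.regFinite
    have := T₂.regFinite
    infer_instance
  start := some (T₁.start, T₂.start, false, false)
  final := {none}
  trans :=
    interRead T₁ T₂ '' ({p ∈ T₁.trans ×ˢ T₂.trans |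
      p.1.cond ≠ none ∧ p.2.cond ≠ none ∧ p.1.out = p.2.out} ×ˢ Set.univ) ∪
    interEpsLeft T₁ T₂ '' ({δ ∈ T₁.trans | δ.cond = none} ×ˢ Set.univ) ∪
    interEpsRight T₁ T₂ '' ({δ ∈ T₂.trans | δ.cond = none} ×ˢ Set.univ) ∪
    interAccept T₁ T₂ '' (T₁.final ×ˢ T₂.final)
  transFinite := by
    have := T₁.stateFinite
    have := T₂.stateFinite
    have h₁ := T₁.transFinite
    have h₂ := T₂.transFinite
    exact (((((h₁.prod h₂).sep _).prod Set.finite_univ).image _).union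
      (((h₁.sep _).prod Set.finite_univ).image _)).union
      (((h₂.sep _).prod Set.finite_univ).image _) |>.union ((Set.toFinite _).image _)

variable {T₁ T₂}

theorem updateW_comp_inl {R₁ R₂ : Type*} (v : Val U (R₁ ⊕ R₂)) (W₁ : Set R₁) (W₂ : Set R₂)
    (u : U) : (v.updateW (Sum.inl '' W₁ ∪ Sum.inr '' W₂) u : Val U (R₁ ⊕ R₂)) ∘ Sum.inl =
      Val.updateW (v ∘ Sum.inl) W₁ u := by
  ext1 r
  simp [Val.updateW]

theorem updateW_comp_inr {R₁ R₂ : Type*} (v : Val U (R₁ ⊕ R₂)) (W₁ : Set R₁) (W₂ : Set R₂)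
    (u : U) : (v.updateW (Sum.inl '' W₁ ∪ Sum.inr '' W₂) u : Val U (R₁ ⊕ R₂)) ∘ Sum.inr =
      Val.updateW (v ∘ Sum.inr) W₂ u := by
  ext1 r
  simp [Val.updateW]

/-- The component configurations of a product configuration are reachable; in the accepting
state, they are those of the preceding product configuration. -/
def InterInv (S : List U) (M : Finset ℕ) (j : ℕ) (v : Val U (T₁.Reg ⊕ T₂.Reg)) :
    InterState T₁ T₂ → Prop
  | some (q₁, q₂, b₁, b₂) =>
      T₁.MReach S M (T₁.init, false) (⟨j, q₁, v ∘ Sum.inl⟩, b₁) ∧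
      T₂.MReach S M (T₂.init, false) (⟨j, q₂, v ∘ Sum.inr⟩, b₂)
  | none => ∃ q₁ ∈ T₁.final, ∃ q₂ ∈ T₂.final,
      T₁.MReach S M (T₁.init, false) (⟨j, q₁, v ∘ Sum.inl⟩, true) ∧
      T₂.MReach S M (T₂.init, false) (⟨j, q₂, v ∘ Sum.inr⟩, true)

theorem interInv_of_mReach {x : (inter T₁ T₂).FlagConfig}
    (h : (inter T₁ T₂).MReach S M ((inter T₁ T₂).init, false) x) :
    InterInv S M x.1.pos x.1.val x.1.state := by
  induction h with
  | refl => exact ⟨.refl, .refl⟩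
  | tail _ hs ih =>
    cases hs with
    | eps j v b hδ hc =>
      obtain ((⟨⟨⟨δ₁, δ₂⟩, b₁, b₂⟩, ⟨⟨-, h₁, h₂, -⟩, -⟩, rfl⟩ |
        ⟨⟨δ₁, q₂, b₁, b₂⟩, ⟨⟨hδ₁, hc₁⟩, -⟩, rfl⟩) |
        ⟨⟨δ₂, q₁, b₁, b₂⟩, ⟨⟨hδ₂, hc₂⟩, -⟩, rfl⟩) | ⟨⟨q₁, q₂⟩, ⟨hq₁, hq₂⟩, rfl⟩ := hδ
      · obtain ⟨φ₁, h₁⟩ := Option.ne_none_iff_exists'.1 h₁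
        obtain ⟨φ₂, h₂⟩ := Option.ne_none_iff_exists'.1 h₂
        exact absurd ((interRead_cond h₁ h₂ _).symm.trans hc) (Option.some_ne_none _)
      · exact ⟨ih.1.tail (.eps _ _ _ hδ₁ hc₁), ih.2⟩
      · exact ⟨ih.1, ih.2.tail (.eps _ _ _ hδ₂ hc₂)⟩
      · exact ⟨q₁, hq₁, q₂, hq₂, ih.1, ih.2⟩
    | read j v b hδ hc hu hφ hM =>
      obtain ((⟨⟨⟨δ₁, δ₂⟩, b₁, b₂⟩, ⟨⟨⟨hδ₁, hδ₂⟩, h₁, h₂, ho⟩, -⟩, rfl⟩ |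
        ⟨_, -, rfl⟩) | ⟨_, -, rfl⟩) | ⟨_, -, rfl⟩ := hδ
      · obtain ⟨φ₁, h₁⟩ := Option.ne_none_iff_exists'.1 h₁
        obtain ⟨φ₂, h₂⟩ := Option.ne_none_iff_exists'.1 h₂
        obtain rfl := Option.some.inj ((interRead_cond h₁ h₂ _).symm.trans hc)
        have r₁ := ih.1.tail (.read _ _ _ hδ₁ h₁ hu hφ.1 hM)
        have r₂ := ih.2.tail (.read _ _ _ hδ₂ h₂ hu hφ.2 (ho ▸ hM))
        rw [← updateW_comp_inl v _ δ₂.wr] at r₁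
        rw [← updateW_comp_inr v δ₁.wr] at r₂
        exact ⟨r₁, r₂⟩
      all_goals exact absurd hc (by simp [interEpsLeft, interEpsRight, interAccept])

/-- The product configuration formed from component configurations. -/
def interConfig (x : T₁.FlagConfig) (y : T₂.FlagConfig) :
    SRTConfig U (inter T₁ T₂).State (inter T₁ T₂).Reg :=
  ⟨x.1.pos, some (x.1.state, y.1.state, x.2, y.2), Sum.elim x.1.val y.1.val⟩

theorem interConfig_init :
    interConfig (T₁ := T₁) (T₂ := T₂) (T₁.init, false) (T₂.init, false) = (inter T₁ T₂).init := by
  simp only [interConfig, init, inter, SRTConfig.mk.injEq, true_and]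
  ext1 (r | r) <;> rfl

theorem mStep_inter_epsRight {x : T₁.FlagConfig} {δ : SRTTransition U T₂.State T₂.Reg} {j : ℕ}
    {v : Val U T₂.Reg} (c b : Bool) (hδ : δ ∈ T₂.trans) (hc : δ.cond = none) :
    (inter T₁ T₂).MStep S M (interConfig x (⟨j, δ.src, v⟩, b), c)
      (interConfig x (⟨j, δ.tgt, v⟩, δ.out), false) :=
  .eps (T := inter T₁ T₂) (δ := interEpsRight T₁ T₂ (δ, x.1.state, x.2, b)) _ _ _
    (.inl (.inr ⟨_, ⟨⟨hδ, hc⟩, trivial⟩, rfl⟩)) rfl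

theorem mStep_inter_epsLeft {y : T₂.FlagConfig} {δ : SRTTransition U T₁.State T₁.Reg} {j : ℕ}
    {v : Val U T₁.Reg} (c b : Bool) (hδ : δ ∈ T₁.trans) (hc : δ.cond = none) :
    (inter T₁ T₂).MStep S M (interConfig (⟨j, δ.src, v⟩, b) y, c)
      (interConfig (⟨j, δ.tgt, v⟩, δ.out) y, false) :=
  .eps (T := inter T₁ T₂) (δ := interEpsLeft T₁ T₂ (δ, y.1.state, b, y.2)) _ _ _
    (.inl (.inl (.inr ⟨_, ⟨⟨hδ, hc⟩, trivial⟩, rfl⟩))) rfl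

theorem mStep_inter_read {δ₁ : SRTTransition U T₁.State T₁.Reg}
    {δ₂ : SRTTransition U T₂.State T₂.Reg} {φ₁ : Cond U T₁.Reg} {φ₂ : Cond U T₂.Reg} {u : U}
    {j : ℕ} {v₁ : Val U T₁.Reg} {v₂ : Val U T₂.Reg} (c b₁ b₂ : Bool)
    (hδ₁ : δ₁ ∈ T₁.trans) (hδ₂ : δ₂ ∈ T₂.trans) (hc₁ : δ₁.cond = some φ₁)
    (hc₂ : δ₂.cond = some φ₂) (hu : S[j - 1]? = some u) (h₁ : φ₁ u v₁) (h₂ : φ₂ u v₂)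
    (hM₁ : δ₁.out = true ↔ j ∈ M) (hM₂ : δ₂.out = true ↔ j ∈ M) :
    (inter T₁ T₂).MStep S M
      (interConfig (⟨j, δ₁.src, v₁⟩, b₁) (⟨j, δ₂.src, v₂⟩, b₂), c)
      (interConfig (⟨j + 1, δ₁.tgt, v₁.updateW δ₁.wr u⟩, δ₁.out)
        (⟨j + 1, δ₂.tgt, v₂.updateW δ₂.wr u⟩, δ₂.out), δ₁.out) := by
  have key := MStep.read (T := inter T₁ T₂) (S := S) (M := M)
    (δ := interRead T₁ T₂ ((δ₁, δ₂), b₁, b₂))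
    (φ := fun u v => φ₁ u (v ∘ Sum.inl) ∧ φ₂ u (v ∘ Sum.inr)) j (Sum.elim v₁ v₂) c
    (.inl (.inl (.inl ⟨_, ⟨⟨⟨hδ₁, hδ₂⟩, by simp [hc₁], by simp [hc₂],
      Bool.eq_iff_iff.2 (hM₁.trans hM₂.symm)⟩, trivial⟩, rfl⟩)))
    (interRead_cond hc₁ hc₂ _) hu ⟨h₁, h₂⟩ hM₁
  have hv : Sum.elim (v₁.updateW δ₁.wr u) (v₂.updateW δ₂.wr u) =
      Val.updateW (Sum.elim v₁ v₂) (Sum.inl '' δ₁.wr ∪ Sum.inr '' δ₂.wr) u := by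
    ext1 (r | r) <;> simp [Val.updateW]
  simp only [interConfig, hv]
  exact key

theorem mReach_inter {x : T₁.FlagConfig} {y : T₂.FlagConfig}
    (hx : T₁.MReach S M (T₁.init, false) x) (hy : T₂.MReach S M (T₂.init, false) y)
    (hpos : x.1.pos = y.1.pos) :
    ∃ b, (inter T₁ T₂).MReach S M ((inter T₁ T₂).init, false) (interConfig x y, b) := by
  induction hx generalizing y with
  | refl =>
    induction hy with
    | refl => exact ⟨false, by rw [interConfig_init]⟩
    | tail hr hs ih =>
      cases hs with
      | eps j v b hδ hc =>
        obtain ⟨c, ih⟩ := ih hpos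
        exact ⟨_, ih.tail (mStep_inter_epsRight _ _ hδ hc)⟩
      | read j v b =>
        have := MReach.one_le_pos hr
        simp only [init] at hpos this
        omega
  | tail hr hs ih =>
    cases hs with
    | eps j v b hδ hc =>
      obtain ⟨c, ih⟩ := ih hy hpos
      exact ⟨_, ih.tail (mStep_inter_epsLeft _ _ hδ hc)⟩
    | read j v b hδ hc hu hφ hM =>
      induction hy with
      | refl =>
        have := MReach.one_le_pos hr
        simp only [init] at hpos this
        omega
      | tail hr₂ hs₂ ih₂ =>
        cases hs₂ with
        | eps j₂ v₂ b₂ hδ₂ hc₂ =>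
          obtain ⟨c, ih₂⟩ := ih₂ hpos
          exact ⟨_, ih₂.tail (mStep_inter_epsRight _ _ hδ₂ hc₂)⟩
        | read j₂ v₂ b₂ hδ₂ hc₂ hu₂ hφ₂ hM₂ =>
          obtain rfl : j = j₂ := Nat.succ_injective hpos
          obtain rfl := Option.some.inj (hu.symm.trans hu₂)
          obtain ⟨c, ih⟩ := ih hr₂ rfl
          exact ⟨_, ih.tail (mStep_inter_read _ _ _ hδ hδ₂ hc hc₂ hu hφ hφ₂ hM hM₂)⟩

theorem accMatch_inter_iff :
    (inter T₁ T₂).AccMatch S M ↔ T₁.AccMatch S M ∧ T₂.AccMatch S M := by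
  simp only [accMatch_iff]
  constructor
  · rintro ⟨hM, q, rfl, v, h⟩
    obtain ⟨q₁, hq₁, q₂, hq₂, h₁, h₂⟩ := interInv_of_mReach h
    exact ⟨⟨hM, q₁, hq₁, _, h₁⟩, ⟨hM, q₂, hq₂, _, h₂⟩⟩
  · rintro ⟨⟨hM, q₁, hq₁, v₁, h₁⟩, ⟨-, q₂, hq₂, v₂, h₂⟩⟩
    obtain ⟨b, h⟩ := mReach_inter h₁ h₂ rfl
    exact ⟨hM, none, rfl, _, h.tail (.eps (T := inter T₁ T₂)
      (δ := interAccept T₁ T₂ (q₁, q₂)) _ _ _ (.inr ⟨_, ⟨hq₁, hq₂⟩, rfl⟩) rfl)⟩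

end Inter

end SRT

/-- SRT are closed under intersection. -/
theorem srt_closed_inter {U : Type*} [Nonempty U] (T₁ T₂ : SRT U) :
    ∃ T : SRT U, ∀ S : List U,
      T.MatchSet S = T₁.MatchSet S ∩ T₂.MatchSet S :=
  ⟨SRT.inter T₁ T₂, fun _ => Set.ext fun _ => SRT.accMatch_inter_iff⟩
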